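/- arXiv:1906.11958 — 3 statements merged into one kernel-verified Lean document; each statement's English description precedes it below -/
import Mathlib

section
/- Let R be a nonzero ring and G a group admitting an injective group homomorphism G → GL_m(R) for some m ≥ 1. Then there exists n₀ such that for every n ≥ n₀ there is an injective group homomorphism λ : G → GL_n(R[X]), where R[X] is the univariate polynomial ring over R, such that for every g ∈ G with g ≠ 1 and all indices i ≠ j in {1,…,n}, the (i,j)-entry of λ(g) is nonzero. -/
open Polynomial

/-- If `V * U = 1`, then `g ↦ 1 + U (f g - 1) V` is a representation whenever `f` is. -/
def Matrix.inflate {S G ι κ : Type*} [Ring S] [Group G] [Fintype ι] [DecidableEq ι]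
    [Fintype κ] [DecidableEq κ] (U : Matrix ι κ S) (V : Matrix κ ι S) (hVU : V * U = 1)
    (f : G →* (Matrix κ κ S)ˣ) : G →* (Matrix ι ι S)ˣ :=
  MonoidHom.toHomUnits
    { toFun := fun g => 1 + U * ((f g).val - 1) * V
      map_one' := by simp
      map_mul' := fun g h => by
        have key : ∀ B C : Matrix κ κ S, U * B * V * (U * C * V) = U * (B * C) * V := by
          intro B C
          calc U * B * V * (U * C * V) = U * B * (V * U) * C * V := by
                simp only [Matrix.mul_assoc]
            _ = U * (B * C) * V := by simp only [hVU, Matrix.mul_one, Matrix.mul_assoc]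
        have expand : (f (g * h)).val - 1 =
            ((f g).val - 1) + ((f h).val - 1) + ((f g).val - 1) * ((f h).val - 1) := by
          rw [map_mul, Units.val_mul]
          noncomm_ring
        rw [expand, add_mul 1, mul_add, mul_one, one_mul, mul_add, mul_one, key]
        simp only [Matrix.mul_add, Matrix.add_mul]
        abel }

theorem Matrix.inflate_val {S G ι κ : Type*} [Ring S] [Group G] [Fintype ι] [DecidableEq ι]
    [Fintype κ] [DecidableEq κ] (U : Matrix ι κ S) (V : Matrix κ ι S) (hVU : V * U = 1)
    (f : G →* (Matrix κ κ S)ˣ) (g : G) :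
    (Matrix.inflate U V hVU f g).val = 1 + U * ((f g).val - 1) * V := rfl

theorem Matrix.inflate_injective {S G ι κ : Type*} [Ring S] [Group G] [Fintype ι]
    [DecidableEq ι] [Fintype κ] [DecidableEq κ] (U : Matrix ι κ S) (V : Matrix κ ι S)
    (hVU : V * U = 1) (f : G →* (Matrix κ κ S)ˣ) (hf : Function.Injective f) :
    Function.Injective (Matrix.inflate U V hVU f) := by
  have key : ∀ B : Matrix κ κ S, V * (U * B * V) * U = B := by
    intro B
    calc V * (U * B * V) * U = (V * U) * B * (V * U) := by simp only [Matrix.mul_assoc]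
      _ = B := by simp only [hVU, Matrix.mul_one, Matrix.one_mul]
  intro g h hgh
  have hval := congrArg Units.val hgh
  rw [Matrix.inflate_val, Matrix.inflate_val] at hval
  have hB := congrArg (fun M => V * M * U) (add_left_cancel hval)
  simp only [key] at hB
  exact hf (Units.ext (sub_left_injective hB))

/-- A bilinear expression in polynomials is nonzero if the degrees of the products of the
polynomials are pairwise distinct and their leading coefficients are units. -/
theorem Polynomial.sum_mul_C_mul_ne_zero {R κ : Type*} [Ring R] [Fintype κ]
    (u v : κ → R[X]) (a b : κ → ℕ) (c d : R) (hc : IsUnit c) (hd : IsUnit d)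
    (hab : Function.Injective fun x : κ × κ => a x.1 + b x.2)
    (hu : ∀ k, (u k).natDegree ≤ a k) (huc : ∀ k, (u k).coeff (a k) = c)
    (hv : ∀ l, (v l).natDegree ≤ b l) (hvd : ∀ l, (v l).coeff (b l) = d)
    (B : Matrix κ κ R) (hB : B ≠ 0) :
    ∑ x : κ × κ, u x.1 * C (B x.1 x.2) * v x.2 ≠ 0 := by
  classical
  have hne : (Finset.univ.filter fun x : κ × κ => B x.1 x.2 ≠ 0).Nonempty := by
    by_contra h
    refine hB (Matrix.ext fun k l => ?_)
    by_contra hkl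
    exact h ⟨(k, l), by simpa using hkl⟩
  obtain ⟨y, hy, hmax⟩ := Finset.exists_max_image _ (fun x : κ × κ => a x.1 + b x.2) hne
  simp only [Finset.mem_filter, Finset.mem_univ, true_and] at hy hmax
  have hdeg : ∀ x : κ × κ, (u x.1 * C (B x.1 x.2)).natDegree ≤ a x.1 := fun x =>
    (natDegree_mul_C_le _ _).trans (hu _)
  intro h0
  have hcoeff := congrArg (fun p => p.coeff (a y.1 + b y.2)) h0
  simp only [finsetSum_coeff, coeff_zero] at hcoeff
  rw [Finset.sum_eq_single y] at hcoeff
  · rw [coeff_mul_add_eq_of_natDegree_le (hdeg y) (hv _), coeff_mul_C, huc, hvd,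
      hd.mul_left_eq_zero, hc.mul_right_eq_zero] at hcoeff
    exact hy hcoeff
  · intro x _ hxy
    by_cases hx : B x.1 x.2 = 0
    · simp [hx]
    · refine coeff_eq_zero_of_natDegree_lt ?_
      exact (natDegree_mul_le_of_le (hdeg x) (hv _)).trans_lt
        (lt_of_le_of_ne (hmax x hx) fun h => hxy (hab h))
  · simp

/-- Mutually inverse rectangular integral polynomial matrices, with unit leading coefficients
and with the degrees of all products `U i k * V l j` pairwise distinct for fixed `i` and `j`. -/
theorem exists_polynomial_matrices_mul_eq_one (N : ℕ) :
    ∃ (U : Matrix (Fin (N + 1)) (Fin N) ℤ[X]) (V : Matrix (Fin N) (Fin (N + 1)) ℤ[X]),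
      V * U = 1 ∧
      (∀ i, ∃ (p : ℕ) (c : ℤ), IsUnit c ∧
        ∀ k, (U i k).natDegree ≤ p + k ∧ (U i k).coeff (p + k) = c) ∧
      (∀ j, ∃ (q : ℕ) (d : ℤ), IsUnit d ∧
        ∀ l : Fin N, (V l j).natDegree ≤ q + N * l ∧ (V l j).coeff (q + N * l) = d) := by
  refine ⟨Matrix.of fun i k => Fin.lastCases (motive := fun _ => ℤ[X]) (X ^ (k : ℕ))
      (fun i' => (1 : Matrix (Fin N) (Fin N) ℤ[X]) i' k + X ^ (1 + k : ℕ)) i,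
    Matrix.of fun l j => Fin.lastCases (motive := fun _ => ℤ[X])
      (-(X + X ^ (1 + N * l : ℕ) * (1 + ∑ k : Fin N, X ^ (1 + k : ℕ))))
      (fun j' => (1 : Matrix (Fin N) (Fin N) ℤ[X]) l j' + X ^ (1 + j' + N * l : ℕ)) j, ?_, ?_, ?_⟩
  · ext1 l k
    rw [Matrix.mul_apply, Fin.sum_univ_castSucc]
    simp only [Matrix.of_apply, Fin.lastCases_castSucc, Fin.lastCases_last, add_mul, mul_add,
      Finset.sum_add_distrib]
    have h1 : ∑ i : Fin N, (X : ℤ[X]) ^ (1 + (i : ℕ) + N * l) * X ^ (1 + k : ℕ) =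
        X ^ (1 + N * l : ℕ) * (∑ i : Fin N, X ^ (1 + i : ℕ)) * X ^ (k : ℕ) := by
      rw [Finset.mul_sum, Finset.sum_mul]
      exact Finset.sum_congr rfl fun i _ => by ring
    rw [h1]
    simp only [Matrix.one_apply, ite_mul, mul_ite, one_mul, mul_one, zero_mul, mul_zero,
      Finset.sum_ite_eq, Finset.sum_ite_eq', Finset.mem_univ, if_true]
    ring
  · intro i
    induction i using Fin.lastCases with
    | last =>
      refine ⟨0, 1, isUnit_one, fun k => ?_⟩
      simp
    | cast i =>
      refine ⟨1, 1, isUnit_one, fun k => ?_⟩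
      simp only [Matrix.of_apply, Fin.lastCases_castSucc, Matrix.one_apply]
      split_ifs
      · refine ⟨by compute_degree!, ?_⟩
        simp [coeff_one]
      · simp
  · intro j
    induction j using Fin.lastCases with
    | last =>
      refine ⟨1 + N, -1, isUnit_one.neg, fun l => ?_⟩
      have hN : 0 < N := l.pos
      have hS : (∑ k : Fin N, (X : ℤ[X]) ^ (1 + k : ℕ)).natDegree ≤ N :=
        natDegree_sum_le_of_forall_le _ _ fun k _ => (natDegree_X_pow_le _).trans (by omega)
      have hSN : (∑ k : Fin N, (X : ℤ[X]) ^ (1 + k : ℕ)).coeff N = 1 := by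
        rw [finsetSum_coeff, Finset.sum_eq_single ⟨N - 1, by omega⟩]
        · rw [coeff_X_pow, if_pos (show N = 1 + (N - 1) by omega)]
        · intro k _ hk
          rw [coeff_X_pow, if_neg fun h => hk (Fin.ext (show (k : ℕ) = N - 1 by omega))]
        · simp
      simp only [Matrix.of_apply, Fin.lastCases_last]
      constructor
      · rw [natDegree_neg]
        refine natDegree_add_le_of_degree_le (natDegree_X_le.trans (by omega)) ?_
        refine (natDegree_mul_le_of_le (natDegree_X_pow_le _)
          (natDegree_add_le_of_degree_le (by simp) hS)).trans (by omega)
      · rw [coeff_neg, coeff_add, coeff_X_of_ne_one (by omega),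
          show 1 + N + N * (l : ℕ) = N + (1 + N * l) by ring, coeff_X_pow_mul, coeff_add, hSN,
          coeff_one, if_neg hN.ne', zero_add, zero_add]
    | cast j =>
      refine ⟨1 + j, 1, isUnit_one, fun l => ?_⟩
      simp only [Matrix.of_apply, Fin.lastCases_castSucc, Matrix.one_apply]
      split_ifs
      · refine ⟨by compute_degree!, ?_⟩
        rw [coeff_add, coeff_one, coeff_X_pow]
        simp
      · simp


/-- **Lemma (non-zero entries).** Let `R` be a nonzero ring and `G` a group linear over `R`
via some faithful representation in `GL_m(R)`, `m ≥ 1`. Then for all sufficiently large `n`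
there is an injective homomorphism `λ : G → GL_n(R[X])` such that every off-diagonal entry
of `λ g` is nonzero, for every nontrivial `g ∈ G`. -/
theorem exists_representation_nonzero_offDiagonal_entries
    (R : Type) [Ring R] [Nontrivial R]
    (G : Type) [Group G] (m : ℕ) (hm : 1 ≤ m)
    (f : G →* (Matrix (Fin m) (Fin m) R)ˣ) (hf : Function.Injective f) :
    ∃ n₀ : ℕ, ∀ n : ℕ, n₀ ≤ n →
      ∃ lam : G →* (Matrix (Fin n) (Fin n) (Polynomial R))ˣ,
        Function.Injective lam ∧
        ∀ g : G, g ≠ 1 → ∀ i j : Fin n, i ≠ j →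
          (lam g).val i j ≠ 0 := by
  classical
  refine ⟨m + 1, fun n hn => ?_⟩
  obtain ⟨N, rfl⟩ : ∃ N, n = N + 1 := ⟨n - 1, by omega⟩
  have hmN : m ≤ N := by omega
  obtain ⟨U, V, hVU, hU, hV⟩ := exists_polynomial_matrices_mul_eq_one N
  let φ : ℤ[X] →+* R[X] := mapRingHom (Int.castRingHom R)
  let e : Fin m → Fin N := Fin.castLE hmN
  let U' : Matrix (Fin (N + 1)) (Fin m) R[X] := (U.map φ).submatrix id e
  let V' : Matrix (Fin m) (Fin (N + 1)) R[X] := (V.map φ).submatrix e id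
  have hVU' : V' * U' = 1 := by
    rw [← Matrix.submatrix_mul _ _ e id e Function.bijective_id, ← Matrix.map_mul, hVU,
      Matrix.map_one φ (map_zero φ) (map_one φ),
      Matrix.submatrix_one e (Fin.castLE_injective hmN)]
  let F : G →* (Matrix (Fin m) (Fin m) R[X])ˣ :=
    (Units.map (RingHom.mapMatrix (m := Fin m) (C : R →+* R[X])).toMonoidHom).comp f
  have hF : Function.Injective F :=
    (Units.map_injective (Matrix.map_injective C_injective)).comp hf
  refine ⟨Matrix.inflate U' V' hVU' F, Matrix.inflate_injective U' V' hVU' F hF,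
    fun g hg i j hij => ?_⟩
  have hB : (f g).val - 1 ≠ 0 := fun h =>
    hg (hf (by rw [map_one]; exact Units.ext (sub_eq_zero.mp h)))
  have hFB : (F g).val - 1 = ((f g).val - 1).map C :=
    (map_sub (RingHom.mapMatrix (C : R →+* R[X])) (f g).val 1 |>.trans
      (by rw [map_one]; rfl)).symm
  obtain ⟨p, c, hc, hUi⟩ := hU i
  obtain ⟨q, d, hd, hVj⟩ := hV j
  have key := Polynomial.sum_mul_C_mul_ne_zero (fun k => U' i k) (fun l => V' l j)
    (fun k => p + e k) (fun l => q + N * e l) (c : R) (d : R)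
    (hc.map (Int.castRingHom R)) (hd.map (Int.castRingHom R)) ?_
    (fun k => natDegree_map_le.trans (hUi _).1)
    (fun k => (coeff_map _ _).trans (congrArg _ (hUi _).2))
    (fun l => natDegree_map_le.trans (hVj _).1)
    (fun l => (coeff_map _ _).trans (congrArg _ (hVj _).2)) _ hB
  · rw [Matrix.inflate_val, Matrix.add_apply, Matrix.one_apply_ne hij, zero_add, hFB,
      Matrix.mul_apply]
    simp only [Matrix.mul_apply, Finset.sum_mul]
    rw [Finset.sum_comm, ← Fintype.sum_prod_type']
    exact key
  · rintro ⟨k, l⟩ ⟨k', l'⟩ h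
    have hinj : (k : ℕ) + N * l = k' + N * l' := by
      have : p + (k : ℕ) + (q + N * l) = p + k' + (q + N * l') := h
      omega
    have hk : (k : ℕ) < N := k.2.trans_le hmN
    have hk' : (k' : ℕ) < N := k'.2.trans_le hmN
    have hmod := congrArg (· % N) hinj
    simp only [Nat.add_mul_mod_self_left, Nat.mod_eq_of_lt hk, Nat.mod_eq_of_lt hk'] at hmod
    have hdiv : N * (l : ℕ) = N * l' := by omega
    exact Prod.ext (Fin.ext hmod) (Fin.ext (Nat.eq_of_mul_eq_mul_left (by omega) hdiv))
end

section
/- For every natural number n there exists an injective ring homomorphism from the field of rational functions ℂ(t_1,…,t_n) — i.e., the field of fractions of the multivariate polynomial ring ℂ[t_1,…,t_n] — into ℂ. In other words, ℂ(t_1,…,t_n) is isomorphic to a subfield of ℂ. -/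
open Cardinal in
/-- A field of characteristic zero with the cardinality of the continuum embeds into `ℂ`. -/
theorem exists_injective_ringHom_complex_of_cardinalMk_eq_continuum (K : Type) [Field K]
    [CharZero K] (hK : #K = 𝔠) : ∃ f : K →+* ℂ, Function.Injective f := by
  have : CharZero (AlgebraicClosure K) :=
    charZero_of_injective_algebraMap (algebraMap K (AlgebraicClosure K)).injective
  have hcard : #(AlgebraicClosure K) = 𝔠 := by
    apply le_antisymm
    · exact (Algebra.IsAlgebraic.cardinalMk_le_max K _).trans (max_le hK.le aleph0_le_continuum)
    · exact hK ▸ mk_le_of_injective (algebraMap K (AlgebraicClosure K)).injective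
  obtain ⟨e⟩ := IsAlgClosed.ringEquiv_of_equiv_of_charZero (K := AlgebraicClosure K) (L := ℂ)
    (hcard ▸ aleph0_lt_continuum) (Cardinal.eq.mp (hcard.trans mk_complex.symm))
  exact ⟨e.toRingHom.comp (algebraMap K _), RingHom.injective _⟩

open Cardinal in
theorem cardinalMk_fractionRing_mvPolynomial_complex (σ : Type) [Countable σ] :
    #(FractionRing (MvPolynomial σ ℂ)) = 𝔠 := by
  rw [mk_fractionRing]
  apply le_antisymm
  · refine MvPolynomial.cardinalMk_le_max.trans ?_
    simp [mk_complex, aleph0_le_continuum, (mk_le_aleph0 (α := σ)).trans aleph0_le_continuum]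
  · exact mk_complex ▸ mk_le_of_injective (MvPolynomial.C_injective σ ℂ)

/-- **Lemma.** For every `n`, the field `ℂ(t₁, …, t_n)` of rational functions in `n`
variables over `ℂ` (the field of fractions of the polynomial ring `ℂ[t₁, …, t_n]`)
embeds into `ℂ`; that is, it is isomorphic to a subfield of `ℂ`. -/
theorem rationalFunctionField_embeds_in_complex (n : ℕ) :
    ∃ f : FractionRing (MvPolynomial (Fin n) ℂ) →+* ℂ, Function.Injective f := by
  have : CharZero (FractionRing (MvPolynomial (Fin n) ℂ)) :=
    charZero_of_injective_algebraMap (IsFractionRing.injective (MvPolynomial (Fin n) ℂ) _)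
  exact exists_injective_ringHom_complex_of_cardinalMk_eq_continuum _
    (cardinalMk_fractionRing_mvPolynomial_complex (Fin n))
end

section
/- Let Γ = (V,E) be a finite simple graph and n : V → ℕ any function. Then there exist a natural number N and a family of subsets J_v ⊆ {1,…,N} (v ∈ V) such that: |J_v| ≥ n(v) for every v; J_u ∩ J_v = ∅ whenever {u,v} ∈ E; |J_u ∩ J_v| ≥ 3 whenever u ≠ v and {u,v} ∉ E; and J_u ∩ J_v ∩ J_w = ∅ for any three pairwise distinct vertices u,v,w. -/
/-- **Existence of well-placed supports.** For a finite simple graph `Γ` and any demanded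
sizes `n : V → ℕ`, there are `N` and subsets `J_v ⊆ {1, …, N}` with `|J_v| ≥ n v`, such that
`J_u ∩ J_v = ∅` for edges `{u,v}`, `|J_u ∩ J_v| ≥ 3` for distinct non-adjacent `u, v`, and
all triple intersections are empty. -/
theorem exists_wellPlaced_supports
    {V : Type} [Fintype V] (Γ : SimpleGraph V) (n : V → ℕ) :
    ∃ (N : ℕ) (J : V → Finset (Fin N)),
      (∀ v, n v ≤ (J v).card) ∧
      (∀ u v : V, Γ.Adj u v → Disjoint (J u) (J v)) ∧
      (∀ u v : V, u ≠ v → ¬Γ.Adj u v → 3 ≤ (J u ∩ J v).card) ∧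
      (∀ u v w : V, u ≠ v → v ≠ w → u ≠ w → J u ∩ J v ∩ J w = ∅) := by
  classical
  let M := 3 + ∑ v, n v
  let e := Fintype.equivFin (Sym2 V × Fin M)
  let J : V → Finset (Fin (Fintype.card (Sym2 V × Fin M))) := fun v =>
    Finset.univ.filter fun i => v ∈ (e.symm i).1 ∧ (e.symm i).1 ∉ Γ.edgeSet
  have hJ (v : V) (i) : i ∈ J v ↔ v ∈ (e.symm i).1 ∧ (e.symm i).1 ∉ Γ.edgeSet := by
    simp [J]
  have hcard (u v : V) (huv : ¬Γ.Adj u v) : M ≤ (J u ∩ J v).card := by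
    have hinj : Function.Injective fun k : Fin M => e (s(u, v), k) := fun a b hab =>
      (Prod.mk.inj (e.injective hab)).2
    calc
      M = (Finset.univ.image fun k : Fin M => e (s(u, v), k)).card := by
        rw [Finset.card_image_of_injective _ hinj, Finset.card_univ, Fintype.card_fin]
      _ ≤ (J u ∩ J v).card := by
        refine Finset.card_le_card fun i hi => ?_
        obtain ⟨k, -, rfl⟩ := Finset.mem_image.1 hi
        simp [hJ, huv]
  refine ⟨_, J, fun v => ?_, fun u v huv => ?_, fun u v _ huv => ?_,
    fun u v w huv hvw huw => ?_⟩
  · have hsum : n v ≤ ∑ u, n u :=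
      Finset.single_le_sum (fun _ _ => Nat.zero_le _) (Finset.mem_univ v)
    have hv := hcard v v Γ.irrefl
    rw [Finset.inter_self] at hv
    exact (hsum.trans (Nat.le_add_left _ _)).trans hv
  · refine Finset.disjoint_left.2 fun i hu hv => ?_
    rw [hJ] at hu hv
    have hi := (Sym2.mem_and_mem_iff huv.ne).1 ⟨hu.1, hv.1⟩
    exact hu.2 (hi ▸ huv)
  · exact (Nat.le_add_right _ _).trans (hcard u v huv)
  · refine Finset.eq_empty_of_forall_notMem fun i hi => ?_
    simp only [Finset.mem_inter, hJ] at hi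
    obtain ⟨⟨hu, hv⟩, hw⟩ := hi
    have hi := (Sym2.mem_and_mem_iff huv).1 ⟨hu.1, hv.1⟩
    rw [hi, Sym2.mem_iff] at hw
    exact hw.1.elim huw.symm hvw.symm
end
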